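/- arXiv:1006.2325 — 3 statements merged into one kernel-verified Lean document; each statement's English description precedes it below -/
import Mathlib

section
/- Let u(z) = Re ∑_{n=1}^{∞} 2^n z^{2^{2^n}} on the open unit disk 𝔻, let c_j = 2^j ∫_{1/2}^{1} r^{2^{2^j}} / ( (1−r)(log(1/(1−r)))² ) dr for j ≥ 1, and let r_k = 1 − 2^{−2^k}. Then there is a constant C > 0 such that for every k ≥ 1, every R ∈ (r_k, r_{k+1}), and every φ ∈ (−π, π], | I_u(R,φ) − ∑_{j=1}^{k} c_j cos(2^{2^j} φ) | ≤ C. -/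
open MeasureTheory Real Filter Set Metric

/-- The weighted radial average `I_u(R,φ)`. -/
noncomputable def Iu (u : ℂ → ℝ) (R φ : ℝ) : ℝ :=
  ∫ r in (1/2 : ℝ)..R, u ((r : ℂ) * Complex.exp (Complex.I * φ)) /
    ((1 - r) * (Real.log (1 / (1 - r))) ^ 2)

/-- The function `u(z) = Re ∑_{n≥1} 2ⁿ z^(2^(2ⁿ))`. -/
noncomputable def uEx (z : ℂ) : ℝ :=
  (∑' n : ℕ, (2 : ℂ) ^ (n + 1) * z ^ (2 ^ (2 ^ (n + 1)))).re

/-- The coefficient `c_j = 2^j ∫_{1/2}^1 r^(2^(2^j)) / ((1−r) (log 1/(1−r))²) dr`. -/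
noncomputable def cCoef (j : ℕ) : ℝ :=
  2 ^ j * ∫ r in (1/2 : ℝ)..1, r ^ (2 ^ (2 ^ j)) / ((1 - r) * (Real.log (1 / (1 - r))) ^ 2)

/-- `r_k = 1 − 2^(−2^k)`. -/
noncomputable def rSeq (k : ℕ) : ℝ := 1 - ((2 : ℝ) ^ (2 ^ k))⁻¹

open scoped Topology

/-- The weight `1 / ((1 - r) (log (1 / (1 - r)))²)`. -/
noncomputable def radialWeight (r : ℝ) : ℝ := 1 / ((1 - r) * (Real.log (1 / (1 - r))) ^ 2)

/-- A primitive of `radialWeight` on `[1/2, 1]`; its value at `1` is `0`. -/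
noncomputable def radialPrimitive (r : ℝ) : ℝ := (Real.log (1 - r))⁻¹

lemma radialWeight_nonneg {r : ℝ} (hr : r ≤ 1) : 0 ≤ radialWeight r := by
  have : 0 ≤ 1 - r := by linarith
  unfold radialWeight
  positivity

lemma hasDerivAt_radialPrimitive {r : ℝ} (h0 : 0 < r) (h1 : r < 1) :
    HasDerivAt radialPrimitive (radialWeight r) r := by
  have hpos : 0 < 1 - r := by linarith
  have hlog : Real.log (1 - r) ≠ 0 := (Real.log_neg hpos (by linarith)).ne
  have h := (((hasDerivAt_id r).const_sub 1).log hpos.ne').inv hlog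
  refine h.congr_deriv ?_
  simp only [radialWeight, id, one_div, Real.log_inv]
  field_simp

lemma continuousOn_radialPrimitive : ContinuousOn radialPrimitive (Icc (1 / 2) 1) := by
  intro r hr
  rcases hr.2.lt_or_eq with h | rfl
  · exact (hasDerivAt_radialPrimitive (by linarith [hr.1]) h).continuousAt.continuousWithinAt
  · have hsub : Tendsto (fun r : ℝ => 1 - r) (𝓝[Iio 1] 1) (𝓝[>] 0) := by
      refine tendsto_nhdsWithin_iff.2 ⟨?_, ?_⟩
      · have : Tendsto (fun r : ℝ => 1 - r) (𝓝 1) (𝓝 (1 - 1)) :=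
          tendsto_const_nhds.sub tendsto_id
        rw [sub_self] at this
        exact this.mono_left nhdsWithin_le_nhds
      · filter_upwards [self_mem_nhdsWithin] with r hr
        simpa using hr
    have hlim : Tendsto radialPrimitive (𝓝[Iio 1] 1) (𝓝 (radialPrimitive 1)) := by
      have : radialPrimitive 1 = 0 := by simp [radialPrimitive]
      rw [this]
      exact tendsto_inv_atBot_zero.comp (Real.tendsto_log_nhdsGT_zero.comp hsub)
    have : ContinuousWithinAt radialPrimitive (Iic 1) 1 := by
      rw [← Iio_union_right]
      exact ContinuousWithinAt.union hlim continuousWithinAt_singleton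
    exact this.mono fun x hx => hx.2

lemma intervalIntegrable_radialWeight {a b : ℝ} (ha : 1 / 2 ≤ a) (hab : a ≤ b) (hb : b ≤ 1) :
    IntervalIntegrable radialWeight volume a b := by
  rw [intervalIntegrable_iff_integrableOn_Ioc_of_le hab]
  refine intervalIntegral.integrableOn_deriv_of_nonneg (g := radialPrimitive)
    (continuousOn_radialPrimitive.mono (Icc_subset_Icc ha hb)) ?_ ?_
  · exact fun x hx => hasDerivAt_radialPrimitive (by linarith [hx.1]) (by linarith [hx.2])
  · exact fun x hx => radialWeight_nonneg (by linarith [hx.2])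

lemma integral_radialWeight {a b : ℝ} (ha : 1 / 2 ≤ a) (hab : a ≤ b) (hb : b ≤ 1) :
    ∫ r in a..b, radialWeight r = radialPrimitive b - radialPrimitive a :=
  intervalIntegral.integral_eq_sub_of_hasDerivAt_of_le hab
    (continuousOn_radialPrimitive.mono (Icc_subset_Icc ha hb))
    (fun x hx => hasDerivAt_radialPrimitive (by linarith [hx.1]) (by linarith [hx.2]))
    (intervalIntegrable_radialWeight ha hab hb)

lemma intervalIntegrable_pow_mul_radialWeight (N : ℕ) {a b : ℝ} (ha : 1 / 2 ≤ a) (hab : a ≤ b)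
    (hb : b ≤ 1) : IntervalIntegrable (fun r => r ^ N * radialWeight r) volume a b :=
  (intervalIntegrable_radialWeight ha hab hb).continuousOn_mul (by fun_prop)

lemma integral_pow_mul_radialWeight_nonneg (N : ℕ) {a b : ℝ} (ha : 1 / 2 ≤ a) (hab : a ≤ b)
    (hb : b ≤ 1) : 0 ≤ ∫ r in a..b, r ^ N * radialWeight r :=
  intervalIntegral.integral_nonneg hab fun r hr =>
    mul_nonneg (pow_nonneg (by linarith [hr.1]) _) (radialWeight_nonneg (hr.2.trans hb))

lemma radialPrimitive_nonpos {r : ℝ} (h0 : 0 ≤ r) (h1 : r ≤ 1) : radialPrimitive r ≤ 0 :=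
  inv_nonpos.2 (Real.log_nonpos (by linarith) (by linarith))

lemma radialPrimitive_mono {a b : ℝ} (ha : 1 / 2 ≤ a) (hab : a ≤ b) (hb : b ≤ 1) :
    radialPrimitive a ≤ radialPrimitive b := by
  have h := integral_radialWeight ha hab hb
  have h' : 0 ≤ ∫ r in a..b, radialWeight r :=
    intervalIntegral.integral_nonneg hab fun r hr => radialWeight_nonneg (hr.2.trans hb)
  linarith

lemma integral_pow_mul_radialWeight_le (N : ℕ) {a b : ℝ} (ha : 1 / 2 ≤ a) (hab : a ≤ b)
    (hb : b ≤ 1) : ∫ r in a..b, r ^ N * radialWeight r ≤ b ^ N * -radialPrimitive a := by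
  have h : ∫ r in a..b, r ^ N * radialWeight r ≤ ∫ r in a..b, b ^ N * radialWeight r := by
    refine intervalIntegral.integral_mono_on hab
      (intervalIntegrable_pow_mul_radialWeight N ha hab hb)
      ((intervalIntegrable_radialWeight ha hab hb).const_mul _) fun r hr => ?_
    have h1 := radialWeight_nonneg (hr.2.trans hb)
    have h2 : 0 ≤ r := by linarith [hr.1]
    have h3 := hr.2
    gcongr
  rw [intervalIntegral.integral_const_mul, integral_radialWeight ha hab hb] at h
  refine h.trans (mul_le_mul_of_nonneg_left ?_ (pow_nonneg (by linarith) _))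
  linarith [radialPrimitive_nonpos (show 0 ≤ b by linarith) hb]

lemma radialPrimitive_rSeq (k : ℕ) : -radialPrimitive (rSeq k) = 1 / (2 ^ k * Real.log 2) := by
  simp [radialPrimitive, rSeq, Real.log_inv, Real.log_pow, inv_neg]

lemma radialPrimitive_half : -radialPrimitive (1 / 2) = 1 / Real.log 2 := by
  have := radialPrimitive_rSeq 0
  norm_num [rSeq] at this ⊢
  exact this

lemma rSeq_mono : Monotone rSeq := fun m n h => by
  unfold rSeq
  gcongr <;> norm_num

lemma half_le_rSeq (k : ℕ) : 1 / 2 ≤ rSeq k := by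
  have := rSeq_mono (Nat.zero_le k)
  norm_num [rSeq] at this ⊢
  linarith

lemma rSeq_lt_one (k : ℕ) : rSeq k < 1 := by
  unfold rSeq
  have : (0 : ℝ) < (2 ^ 2 ^ k)⁻¹ := by positivity
  linarith

lemma two_pow_mul_rSeq_pow_le (m : ℕ) :
    2 ^ (m + 1) * rSeq m ^ (2 ^ (2 ^ (m + 1))) ≤ 2 * (1 / 2 : ℝ) ^ m := by
  set N : ℝ := 2 ^ 2 ^ m with hN
  have hNpos : 0 < N := by positivity
  have hexp : rSeq m ^ (2 ^ (2 ^ (m + 1))) ≤ Real.exp (-N) := by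
    calc rSeq m ^ (2 ^ (2 ^ (m + 1))) ≤ Real.exp (-N⁻¹) ^ (2 ^ (2 ^ (m + 1))) :=
          pow_le_pow_left₀ (le_trans (by norm_num) (half_le_rSeq m)) (Real.one_sub_le_exp_neg _) _
      _ = Real.exp (-N) := by
          rw [← Real.exp_nat_mul]
          congr 1
          have : ((2 ^ 2 ^ (m + 1) : ℕ) : ℝ) = N * N := by
            push_cast
            rw [hN, ← pow_add, pow_succ, mul_two]
          rw [this]
          field_simp
  have hinv : Real.exp (-N) ≤ N⁻¹ := by
    rw [Real.exp_neg]
    exact inv_anti₀ hNpos (by linarith [Real.add_one_le_exp N])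
  have hexponent : 2 * m ≤ 2 ^ m := by
    rcases m with _ | n
    · simp
    · have := Nat.lt_two_pow_self (n := n)
      rw [pow_succ]
      omega
  have hpow : (2 : ℝ) ^ m * 2 ^ m ≤ N := by
    rw [← pow_add, hN]
    exact pow_le_pow_right₀ (by norm_num) (by omega)
  calc 2 ^ (m + 1) * rSeq m ^ (2 ^ (2 ^ (m + 1))) ≤ 2 ^ (m + 1) * N⁻¹ := by
        gcongr; exact hexp.trans hinv
    _ ≤ 2 ^ (m + 1) * ((2 : ℝ) ^ m * 2 ^ m)⁻¹ := by gcongr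
    _ = 2 * (1 / 2 : ℝ) ^ m := by
        rw [one_div, inv_pow]; field_simp; ring

lemma hasSum_head_add_geometric (A B : ℝ) (k : ℕ) :
    HasSum (fun m => (if m ≤ k then 2 ^ (m + 1) * A else 0) + 2 * (1 / 2 : ℝ) ^ m * B)
      ((2 ^ (k + 2) - 2) * A + 4 * B) := by
  have h1 : HasSum (fun m => if m ≤ k then (2 : ℝ) ^ (m + 1) * A else 0)
      ((2 ^ (k + 2) - 2) * A) := by
    have h := hasSum_sum_of_ne_finset_zero (L := .unconditional ℕ) (s := Finset.range (k + 1))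
      (f := fun m => if m ≤ k then (2 : ℝ) ^ (m + 1) * A else 0)
      (fun m hm => if_neg (by simpa using hm))
    convert h using 1
    rw [Finset.sum_congr rfl fun m hm => if_pos (by simpa [Nat.lt_succ_iff] using hm),
      ← Finset.sum_mul]
    congr 1
    simp only [pow_succ (2 : ℝ), ← Finset.sum_mul]
    rw [geom_sum_eq (by norm_num)]
    ring
  have h2 := (hasSum_geometric_two.mul_left 2).mul_right B
  norm_num at h2 ⊢
  exact h1.add h2

lemma two_pow_mul_pow_le {k : ℕ} {R : ℝ} (h0 : 0 ≤ R) (hR : R ≤ rSeq (k + 1)) (m : ℕ) :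
    2 ^ (m + 1) * R ^ (2 ^ (2 ^ (m + 1))) ≤
      (if m ≤ k then 2 ^ (m + 1) * 1 else 0) + 2 * (1 / 2 : ℝ) ^ m * 1 := by
  split_ifs with h
  · have : R ^ (2 ^ (2 ^ (m + 1))) ≤ 1 := pow_le_one₀ h0 (hR.trans (rSeq_lt_one _).le)
    have h3 : (2 : ℝ) ^ (m + 1) * R ^ (2 ^ (2 ^ (m + 1))) ≤ 2 ^ (m + 1) * 1 := by gcongr
    have : (0 : ℝ) ≤ 2 * (1 / 2) ^ m * 1 := by positivity
    linarith
  · have : R ≤ rSeq m := hR.trans (rSeq_mono (by omega))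
    have h3 : (2 : ℝ) ^ (m + 1) * R ^ (2 ^ (2 ^ (m + 1))) ≤
        2 ^ (m + 1) * rSeq m ^ (2 ^ (2 ^ (m + 1))) := by gcongr
    linarith [two_pow_mul_rSeq_pow_le m]

lemma re_term (r φ : ℝ) (m : ℕ) :
    ((2 : ℂ) ^ (m + 1) * (r * Complex.exp (Complex.I * φ)) ^ (2 ^ (2 ^ (m + 1)))).re =
      2 ^ (m + 1) * Real.cos ((2 : ℝ) ^ (2 ^ (m + 1)) * φ) * r ^ (2 ^ (2 ^ (m + 1))) := by
  have h : (2 : ℂ) ^ (m + 1) * (r * Complex.exp (Complex.I * φ)) ^ (2 ^ (2 ^ (m + 1))) =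
      ((2 ^ (m + 1) * r ^ (2 ^ (2 ^ (m + 1))) : ℝ) : ℂ) *
        Complex.exp (((2 : ℝ) ^ (2 ^ (m + 1)) * φ : ℝ) * Complex.I) := by
    rw [mul_pow, ← Complex.exp_nat_mul]
    push_cast
    rw [mul_assoc]
    congr 3
    ring
  rw [h, Complex.re_ofReal_mul, Complex.exp_ofReal_mul_I_re]
  ring

lemma hasSum_uEx {k : ℕ} {r : ℝ} (h0 : 0 ≤ r) (hr : r ≤ rSeq (k + 1)) (φ : ℝ) :
    HasSum (fun m : ℕ => 2 ^ (m + 1) * Real.cos ((2 : ℝ) ^ (2 ^ (m + 1)) * φ) *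
      r ^ (2 ^ (2 ^ (m + 1)))) (uEx (r * Complex.exp (Complex.I * φ))) := by
  have hs : Summable fun m : ℕ =>
      (2 : ℂ) ^ (m + 1) * (r * Complex.exp (Complex.I * φ)) ^ (2 ^ (2 ^ (m + 1))) := by
    refine Summable.of_norm_bounded (hasSum_head_add_geometric 1 1 k).summable fun m => ?_
    refine le_trans (le_of_eq ?_) (two_pow_mul_pow_le h0 hr m)
    have : ‖Complex.exp (Complex.I * φ)‖ = 1 := by
      rw [mul_comm]; exact Complex.norm_exp_ofReal_mul_I φ
    simp [this, abs_of_nonneg h0]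
  simpa only [re_term, uEx] using Complex.hasSum_re hs.hasSum

lemma hasSum_Iu_uEx {k : ℕ} {R : ℝ} (h0 : 1 / 2 ≤ R) (hR : R ≤ rSeq (k + 1)) (φ : ℝ) :
    HasSum (fun m : ℕ => 2 ^ (m + 1) * Real.cos ((2 : ℝ) ^ (2 ^ (m + 1)) * φ) *
      ∫ r in (1 / 2)..R, r ^ (2 ^ (2 ^ (m + 1))) * radialWeight r) (Iu uEx R φ) := by
  have hR1 : R ≤ 1 := hR.trans (rSeq_lt_one _).le
  have hw := intervalIntegrable_radialWeight le_rfl h0 hR1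
  have hb := hasSum_head_add_geometric 1 1 k
  have h := intervalIntegral.hasSum_integral_of_dominated_convergence (μ := volume)
    (a := 1 / 2) (b := R)
    (F := fun m r => 2 ^ (m + 1) * Real.cos ((2 : ℝ) ^ (2 ^ (m + 1)) * φ) *
      (r ^ (2 ^ (2 ^ (m + 1))) * radialWeight r))
    (f := fun r => uEx (r * Complex.exp (Complex.I * φ)) /
      ((1 - r) * (Real.log (1 / (1 - r))) ^ 2))
    (fun m r => ((if m ≤ k then 2 ^ (m + 1) * 1 else 0) + 2 * (1 / 2 : ℝ) ^ m * 1) *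
      radialWeight r) ?_ ?_ ?_ ?_ ?_
  · simpa only [intervalIntegral.integral_const_mul, Iu] using h
  · intro m
    rw [uIoc_of_le h0]
    exact ((intervalIntegrable_pow_mul_radialWeight _ le_rfl h0 hR1).const_mul _).1.1
  · intro m
    refine ae_of_all _ fun r hr => ?_
    rw [uIoc_of_le h0] at hr
    have hr0 : 0 ≤ r := by linarith [hr.1]
    have hwr := radialWeight_nonneg (hr.2.trans hR1)
    rw [← mul_assoc, norm_mul, Real.norm_of_nonneg hwr]
    refine mul_le_mul_of_nonneg_right ?_ hwr
    refine le_trans ?_ (two_pow_mul_pow_le hr0 (hr.2.trans hR) m)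
    rw [norm_mul, norm_mul, Real.norm_of_nonneg (by positivity : (0 : ℝ) ≤ 2 ^ (m + 1)),
      Real.norm_of_nonneg (by positivity : 0 ≤ r ^ (2 ^ (2 ^ (m + 1))))]
    refine mul_le_mul_of_nonneg_right ?_ (by positivity)
    exact mul_le_of_le_one_right (by positivity) (Real.abs_cos_le_one _)
  · exact ae_of_all _ fun r _ => hb.summable.mul_right _
  · simpa only [tsum_mul_right] using hw.const_mul _
  · refine ae_of_all _ fun r hr => ?_
    rw [uIoc_of_le h0] at hr
    have := (hasSum_uEx (by linarith [hr.1]) (hr.2.trans hR) φ).mul_right (radialWeight r)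
    simpa only [mul_assoc, radialWeight, mul_one_div, mul_div_assoc] using this

lemma cCoef_eq (j : ℕ) :
    cCoef j = 2 ^ j * ∫ r in (1 / 2)..1, r ^ (2 ^ (2 ^ j)) * radialWeight r := by
  simp only [cCoef, radialWeight, mul_one_div]

lemma hasSum_sum_cCoef (k : ℕ) (φ : ℝ) :
    HasSum (fun m : ℕ => if m < k then cCoef (m + 1) * Real.cos ((2 : ℝ) ^ (2 ^ (m + 1)) * φ)
      else 0) (∑ j ∈ Finset.Icc 1 k, cCoef j * Real.cos ((2 : ℝ) ^ (2 ^ j) * φ)) := by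
  have h := hasSum_sum_of_ne_finset_zero (L := .unconditional ℕ) (s := Finset.range k)
    (f := fun m : ℕ => if m < k then cCoef (m + 1) * Real.cos ((2 : ℝ) ^ (2 ^ (m + 1)) * φ)
      else 0) (fun m hm => if_neg (by simpa using hm))
  convert h using 1
  rw [Finset.sum_congr rfl fun m hm => if_pos (by simpa using hm), Finset.range_eq_Ico,
    Finset.sum_Ico_add' (fun j => cCoef j * Real.cos ((2 : ℝ) ^ (2 ^ j) * φ)) 0 k 1]
  rfl

lemma abs_term_sub_le {k : ℕ} {R : ℝ} (hk : rSeq k < R) (hR : R < rSeq (k + 1)) (φ : ℝ) (m : ℕ) :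
    ‖2 ^ (m + 1) * Real.cos ((2 : ℝ) ^ (2 ^ (m + 1)) * φ) *
        (∫ r in (1 / 2)..R, r ^ (2 ^ (2 ^ (m + 1))) * radialWeight r) -
      (if m < k then cCoef (m + 1) * Real.cos ((2 : ℝ) ^ (2 ^ (m + 1)) * φ) else 0)‖ ≤
      (if m ≤ k then 2 ^ (m + 1) * (1 / (2 ^ k * Real.log 2)) else 0) +
        2 * (1 / 2 : ℝ) ^ m * (1 / Real.log 2) := by
  have hlog : 0 < Real.log 2 := Real.log_pos (by norm_num)
  have hR0 : 1 / 2 ≤ R := (half_le_rSeq k).trans hk.le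
  have hR1 : R ≤ 1 := hR.le.trans (rSeq_lt_one _).le
  set N := 2 ^ (2 ^ (m + 1)) with hN
  set c := Real.cos ((2 : ℝ) ^ (2 ^ (m + 1)) * φ) with hc
  have key : ∀ J : ℝ, 0 ≤ J → ‖2 ^ (m + 1) * c * J‖ ≤ 2 ^ (m + 1) * J := fun J hJ => by
    rw [norm_mul, norm_mul, Real.norm_of_nonneg hJ,
      Real.norm_of_nonneg (by positivity : (0 : ℝ) ≤ 2 ^ (m + 1))]
    refine mul_le_mul_of_nonneg_right ?_ hJ
    exact mul_le_of_le_one_right (by positivity) (Real.abs_cos_le_one _)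
  have htail : (0 : ℝ) ≤ 2 * (1 / 2) ^ m * (1 / Real.log 2) := by positivity
  have hrm : 2 ^ (m + 1) * (rSeq m ^ N * (1 / Real.log 2)) ≤
      2 * (1 / 2 : ℝ) ^ m * (1 / Real.log 2) := by
    rw [← mul_assoc]
    exact mul_le_mul_of_nonneg_right (two_pow_mul_rSeq_pow_le m) (by positivity)
  rcases lt_trichotomy m k with h | rfl | h
  · rw [if_pos h, if_pos h.le, cCoef_eq]
    have hadd := intervalIntegral.integral_add_adjacent_intervals
      (intervalIntegrable_pow_mul_radialWeight N le_rfl hR0 hR1)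
      (intervalIntegrable_pow_mul_radialWeight N hR0 hR1 le_rfl)
    rw [← hN, ← hadd, norm_sub_rev]
    have hJ := integral_pow_mul_radialWeight_le N hR0 hR1 le_rfl
    have hmono := radialPrimitive_mono (half_le_rSeq k) hk.le hR1
    have hval := radialPrimitive_rSeq k
    rw [one_pow, one_mul] at hJ
    have := key _ (integral_pow_mul_radialWeight_nonneg N hR0 hR1 le_rfl)
    have h2 : (2 : ℝ) ^ (m + 1) * (∫ r in R..1, r ^ N * radialWeight r) ≤
        2 ^ (m + 1) * (1 / (2 ^ k * Real.log 2)) := by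
      gcongr; linarith
    refine le_trans (le_of_eq ?_) ((this.trans h2).trans (le_add_of_nonneg_right htail))
    congr 1
    ring
  · rw [if_neg (lt_irrefl _), if_pos le_rfl, sub_zero]
    refine (key _ (integral_pow_mul_radialWeight_nonneg N le_rfl hR0 hR1)).trans ?_
    have hm1 := (rSeq_lt_one m).le
    rw [← intervalIntegral.integral_add_adjacent_intervals
      (intervalIntegrable_pow_mul_radialWeight N le_rfl (half_le_rSeq m) hm1)
      (intervalIntegrable_pow_mul_radialWeight N (half_le_rSeq m) hk.le hR1), mul_add, add_comm]
    have hJ1 := integral_pow_mul_radialWeight_le N le_rfl (half_le_rSeq m) hm1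
    have hJ2 := integral_pow_mul_radialWeight_le N (half_le_rSeq m) hk.le hR1
    rw [radialPrimitive_half] at hJ1
    rw [radialPrimitive_rSeq] at hJ2
    have hJ2' := hJ2.trans
      (mul_le_of_le_one_left (by positivity) (pow_le_one₀ (by linarith) hR1))
    refine add_le_add (by gcongr) (le_trans (by gcongr) hrm)
  · rw [if_neg (by omega), if_neg (by omega), sub_zero, zero_add]
    refine (key _ (integral_pow_mul_radialWeight_nonneg N le_rfl hR0 hR1)).trans ?_
    have hJ := integral_pow_mul_radialWeight_le N le_rfl hR0 hR1
    rw [radialPrimitive_half] at hJ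
    have hRm : R ≤ rSeq m := hR.le.trans (rSeq_mono (by omega))
    refine le_trans ?_ hrm
    gcongr
    refine hJ.trans ?_
    gcongr

theorem stmt_9 :
    ∃ C : ℝ, 0 < C ∧ ∀ k : ℕ, 1 ≤ k → ∀ R : ℝ, rSeq k < R → R < rSeq (k + 1) →
      ∀ φ ∈ Ioc (-π) π,
        |Iu uEx R φ - ∑ j ∈ Finset.Icc 1 k, cCoef j * Real.cos ((2 : ℝ) ^ (2 ^ j) * φ)| ≤ C := by
  have hlog : 0 < Real.log 2 := Real.log_pos (by norm_num)
  refine ⟨8 / Real.log 2, by positivity, fun k _ R hk hR φ _ => ?_⟩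
  have hsum := (hasSum_Iu_uEx ((half_le_rSeq k).trans hk.le) hR.le φ).sub (hasSum_sum_cCoef k φ)
  have hbound := hasSum_head_add_geometric (1 / (2 ^ k * Real.log 2)) (1 / Real.log 2) k
  have h := tsum_of_norm_bounded hbound (abs_term_sub_le hk hR φ)
  rw [hsum.tsum_eq] at h
  refine h.trans ?_
  have h2 : (2 ^ (k + 2) - 2 : ℝ) * (1 / (2 ^ k * Real.log 2)) ≤
      2 ^ (k + 2) * (1 / (2 ^ k * Real.log 2)) := by
    gcongr; linarith
  have h3 : (2 : ℝ) ^ (k + 2) * (1 / (2 ^ k * Real.log 2)) = 4 / Real.log 2 := by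
    rw [pow_add]; field_simp; norm_num
  have h4 : 8 / Real.log 2 = 4 / Real.log 2 + 4 * (1 / Real.log 2) := by ring
  linarith
end

section
/- Fix a > 2 and set N_n = 2^{2^n}. Define E_n = {φ ∈ (−π, π] : cos(N_n φ) > 1 − n^{−a}}, E_{n,m} = {φ ∈ (−π, π] : cos(N_n φ) > 1 − N_m^{−1}}, F_m = (∪_{n≥m} E_n) ∪ (∪_{1≤n<m} E_{n,m}), and F = ∩_{m≥1} F_m. Then F has Lebesgue measure zero. -/
open MeasureTheory Real Filter Set

/-- `N_n = 2^(2^n)` as a real number. -/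
noncomputable def Nn (n : ℕ) : ℝ := (2 : ℝ) ^ (2 ^ n)

/-- `E_n = {φ ∈ (−π, π] : cos(N_n φ) > 1 − n^(−a)}`. -/
noncomputable def En (a : ℝ) (n : ℕ) : Set ℝ :=
  {φ ∈ Ioc (-π) π | 1 - (n : ℝ) ^ (-a) < Real.cos (Nn n * φ)}

/-- `E_{n,m} = {φ ∈ (−π, π] : cos(N_n φ) > 1 − N_m⁻¹}`. -/
noncomputable def Enm (n m : ℕ) : Set ℝ :=
  {φ ∈ Ioc (-π) π | 1 - (Nn m)⁻¹ < Real.cos (Nn n * φ)}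

/-- `F_m = (∪_{n ≥ m} E_n) ∪ (∪_{1 ≤ n < m} E_{n,m})`. -/
noncomputable def Fm (a : ℝ) (m : ℕ) : Set ℝ :=
  (⋃ n, ⋃ (_ : m ≤ n), En a n) ∪ (⋃ n, ⋃ (_ : 1 ≤ n ∧ n < m), Enm n m)

/-- `F = ∩_{m ≥ 1} F_m`. -/
noncomputable def Fbad (a : ℝ) : Set ℝ :=
  ⋂ m, ⋂ (_ : 1 ≤ m), Fm a m

/-- The points of `(-π, π]` whose `N`-fold multiple is close to `2πℤ` form a set of measure
`O(√δ)`, uniformly in `N`. -/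
theorem volume_one_sub_lt_cos_nat_mul_le {N : ℕ} (hN : 0 < N) {δ : ℝ} (hδ : 0 ≤ δ) :
    volume {φ ∈ Ioc (-π) π | 1 - δ < Real.cos (N * φ)} ≤ ENNReal.ofReal (18 * √δ) := by
  have hN' : (1 : ℝ) ≤ N := by exact_mod_cast hN
  have hsub : {φ ∈ Ioc (-π) π | 1 - δ < Real.cos (N * φ)} ⊆
      ⋃ k ∈ Finset.Icc (-(N : ℤ)) N, Metric.closedBall (2 * π * k / N) (3 * √δ / N) := by
    rintro φ ⟨⟨h1, h2⟩, h3⟩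
    have hr := abs_le.1 (abs_sub_round (N * φ / (2 * π)))
    set k : ℤ := round (N * φ / (2 * π))
    have hpi := pi_pos
    have hx : N * φ = 2 * π * (N * φ / (2 * π)) := by field_simp
    have hub : N * φ / (2 * π) ≤ N / 2 := by
      rw [div_le_div_iff₀ (by positivity) (by positivity)]
      nlinarith
    have hlb : -((N : ℝ) / 2) ≤ N * φ / (2 * π) := by
      rw [← neg_div, div_le_div_iff₀ (by positivity) (by positivity)]
      nlinarith
    have hk : k ∈ Finset.Icc (-(N : ℤ)) N := by
      rw [Finset.mem_Icc]
      constructor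
      · have : -(N : ℝ) ≤ k := by linarith [hr.2]
        exact_mod_cast this
      · have : (k : ℝ) ≤ N := by linarith [hr.1]
        exact_mod_cast this
    simp only [mem_iUnion]
    refine ⟨k, hk, ?_⟩
    have habs : |N * φ - k * (2 * π)| ≤ π := by
      rw [abs_le]
      constructor <;> nlinarith [hr.1, hr.2]
    have hcos := Real.cos_le_one_sub_mul_cos_sq habs
    rw [Real.cos_sub_int_mul_two_pi] at hcos
    have hsq : (N * φ - k * (2 * π)) ^ 2 ≤ (3 * √δ) ^ 2 := by
      rw [mul_pow, Real.sq_sqrt hδ]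
      have h4 : 2 / π ^ 2 * (N * φ - k * (2 * π)) ^ 2 ≤ δ := by linarith
      rw [div_mul_eq_mul_div, div_le_iff₀ (by positivity)] at h4
      have h16 : π ^ 2 ≤ 16 := by nlinarith [pi_le_four]
      nlinarith
    have hd : |N * φ - k * (2 * π)| ≤ 3 * √δ := abs_le_of_sq_le_sq hsq (by positivity)
    rw [Metric.mem_closedBall, Real.dist_eq, le_div_iff₀ (by positivity)]
    calc |φ - 2 * π * k / N| * N = |(φ - 2 * π * k / N) * N| := by
          rw [abs_mul, abs_of_nonneg (by positivity : (0 : ℝ) ≤ N)]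
      _ = |N * φ - k * (2 * π)| := by
          congr 1
          field_simp
      _ ≤ 3 * √δ := hd
  refine (measure_mono hsub).trans ((measure_biUnion_finset_le _ _).trans ?_)
  simp only [Real.volume_closedBall, Finset.sum_const, Int.card_Icc, nsmul_eq_mul]
  rw [← ENNReal.ofReal_natCast, ← ENNReal.ofReal_mul (by positivity)]
  apply ENNReal.ofReal_le_ofReal
  have hcard : (((N : ℤ) + 1 - -(N : ℤ)).toNat : ℝ) = 2 * N + 1 := by
    rw [show (N : ℤ) + 1 - -(N : ℤ) = ((2 * N + 1 : ℕ) : ℤ) by push_cast; ring, Int.toNat_natCast]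
    push_cast
    ring
  rw [hcard, show (2 * (N : ℝ) + 1) * (2 * (3 * √δ / N)) = (2 * N + 1) * (6 * √δ) / N by ring,
    div_le_iff₀ (by positivity)]
  nlinarith [Real.sqrt_nonneg δ]

theorem Nn_eq_natCast (n : ℕ) : Nn n = ((2 ^ 2 ^ n : ℕ) : ℝ) := by
  simp [Nn]

theorem volume_En_le (a : ℝ) (n : ℕ) :
    volume (En a n) ≤ ENNReal.ofReal (18 * (n : ℝ) ^ (-(a / 2))) := by
  have h := volume_one_sub_lt_cos_nat_mul_le (N := 2 ^ 2 ^ n) (by positivity)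
    (Real.rpow_nonneg n.cast_nonneg (-a))
  rw [Real.sqrt_eq_rpow, ← Real.rpow_mul n.cast_nonneg,
    show -a * (1 / 2) = -(a / 2) by ring, ← Nn_eq_natCast] at h
  exact h

theorem volume_Enm_le (n : ℕ) {m : ℕ} (hm : 1 ≤ m) :
    volume (Enm n m) ≤ ENNReal.ofReal (18 * (1 / 2 : ℝ) ^ m) := by
  have h := volume_one_sub_lt_cos_nat_mul_le (N := 2 ^ 2 ^ n) (by positivity)
    (δ := (Nn m)⁻¹) (by unfold Nn; positivity)
  rw [← Nn_eq_natCast] at h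
  refine h.trans (ENNReal.ofReal_le_ofReal ?_)
  gcongr
  apply Real.sqrt_le_iff.2 ⟨by positivity, ?_⟩
  rw [← pow_mul, one_div, inv_pow, Nn]
  have hexp : m * 2 ≤ 2 ^ m := by
    obtain ⟨k, rfl⟩ := Nat.exists_eq_add_of_le' hm
    have := Nat.lt_two_pow_self (n := k)
    rw [pow_succ]
    omega
  gcongr
  norm_num

theorem volume_Fm_le (a : ℝ) {m : ℕ} (hm : 1 ≤ m) :
    volume (Fm a m) ≤ ∑' k, ENNReal.ofReal (18 * ((k + m : ℕ) : ℝ) ^ (-(a / 2))) +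
      ENNReal.ofReal (18 * (m * (1 / 2 : ℝ) ^ m)) := by
  refine (measure_union_le _ _).trans (add_le_add ?_ ?_)
  · have hsub : (⋃ n, ⋃ (_ : m ≤ n), En a n) ⊆ ⋃ k, En a (k + m) := by
      refine iUnion₂_subset fun n hn => ?_
      obtain ⟨k, rfl⟩ := Nat.exists_eq_add_of_le' hn
      exact subset_iUnion (fun k => En a (k + m)) k
    exact (measure_mono hsub).trans ((measure_iUnion_le _).trans
      (ENNReal.tsum_le_tsum fun k => volume_En_le a (k + m)))
  · have hsub : (⋃ n, ⋃ (_ : 1 ≤ n ∧ n < m), Enm n m) ⊆ ⋃ n ∈ Finset.range m, Enm n m :=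
      iUnion₂_subset fun n hn =>
        subset_biUnion_of_mem (u := fun n => Enm n m) (Finset.mem_range.2 hn.2)
    refine (measure_mono hsub).trans ((measure_biUnion_finset_le _ _).trans
      ((Finset.sum_le_sum fun n _ => volume_Enm_le n hm).trans_eq ?_))
    rw [Finset.sum_const, Finset.card_range, nsmul_eq_mul, ← ENNReal.ofReal_natCast,
      ← ENNReal.ofReal_mul m.cast_nonneg]
    congr 1
    ring

theorem tendsto_volume_Fm {a : ℝ} (ha : 2 < a) :
    Tendsto (fun m => volume (Fm a m)) atTop (nhds 0) := by
  have hsum : Summable fun n : ℕ => 18 * (n : ℝ) ^ (-(a / 2)) :=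
    (Real.summable_nat_rpow.2 (by linarith)).mul_left 18
  have htail := ENNReal.tendsto_sum_nat_add _ hsum.tsum_ofReal_ne_top
  have hgeom : Tendsto (fun m : ℕ => ENNReal.ofReal (18 * (m * (1 / 2 : ℝ) ^ m))) atTop
      (nhds 0) := by
    have := ENNReal.tendsto_ofReal ((tendsto_self_mul_const_pow_of_lt_one
      (by norm_num : (0 : ℝ) ≤ 1 / 2) (by norm_num)).const_mul 18)
    simpa only [mul_zero, ENNReal.ofReal_zero] using this
  have hbound := htail.add hgeom
  rw [add_zero] at hbound
  refine tendsto_of_tendsto_of_tendsto_of_le_of_le' tendsto_const_nhds hbound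
    (Eventually.of_forall fun _ => zero_le) ?_
  filter_upwards [eventually_ge_atTop 1] with m hm using volume_Fm_le a hm

theorem stmt_12 (a : ℝ) (ha : 2 < a) : volume (Fbad a) = 0 := by
  refine le_antisymm (ge_of_tendsto (tendsto_volume_Fm ha) ?_) zero_le
  filter_upwards [eventually_ge_atTop 1] with m hm
  exact measure_mono (iInter₂_subset m hm)
end

section
/- Fix a > 2 and set N_n = 2^{2^n}. Define E_n = {φ ∈ (−π, π] : cos(N_n φ) > 1 − n^{−a}}, E_{n,m} = {φ ∈ (−π, π] : cos(N_n φ) > 1 − N_m^{−1}}, and F_m = (∪_{n≥m} E_n) ∪ (∪_{1≤n<m} E_{n,m}). For integers l ≥ 1, j ≥ 1 and φ ∈ (−π, π] set i_{l,j}(φ) = ∫_{1−N_l^{−1}}^{1−N_l^{−2}} 2^j Re[ (r e^{iφ})^{N_j} / ( (r e^{iφ})^{N_j} − 1 ) ] / ( (1−r)(log(1/(1−r)))² ) dr. Then for every m ≥ 1 and every φ ∈ (−π, π] with φ ∉ F_m, there exist γ > 0 and an integer l₀ > m such that for all l > l₀: (i) i_{l,j}(φ) > 0 for every j < l; (ii)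 i_{l,l}(φ) > 2γ; (iii) ∑_{j>l} |i_{l,j}(φ)| < γ. -/
open MeasureTheory Real Filter Set

/-- `i_{l,j}(φ) = ∫_{1−N_l⁻¹}^{1−N_l⁻²} 2^j Re[(re^{iφ})^(N_j)/((re^{iφ})^(N_j)−1)]
      / ((1−r)(log 1/(1−r))²) dr`. -/
noncomputable def iInt (l j : ℕ) (φ : ℝ) : ℝ :=
  ∫ r in (1 - (Nn l)⁻¹)..(1 - ((Nn l) ^ 2)⁻¹),
    2 ^ j * (((r : ℂ) * Complex.exp (Complex.I * (φ : ℂ))) ^ (2 ^ (2 ^ j)) /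
      (((r : ℂ) * Complex.exp (Complex.I * (φ : ℂ))) ^ (2 ^ (2 ^ j)) - 1)).re /
    ((1 - r) * (Real.log (1 / (1 - r))) ^ 2)

/-- The real part of `w / (w - 1)` for `w` of modulus `ρ` and argument with cosine `c`. -/
noncomputable def reKernel (ρ c : ℝ) : ℝ := ρ * (ρ - c) / (1 - 2 * ρ * c + ρ ^ 2)

/-- The denominator `(1 - r) log² (1 / (1 - r))` of the weight in `iInt`. -/
noncomputable def weightDen (r : ℝ) : ℝ := (1 - r) * (Real.log (1 / (1 - r))) ^ 2

theorem re_pow_div_pow_sub_one (r φ : ℝ) (n : ℕ) :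
    (((r : ℂ) * Complex.exp (Complex.I * (φ : ℂ))) ^ n /
      (((r : ℂ) * Complex.exp (Complex.I * (φ : ℂ))) ^ n - 1)).re =
      reKernel (r ^ n) (Real.cos (n * φ)) := by
  have hw : ((r : ℂ) * Complex.exp (Complex.I * (φ : ℂ))) ^ n =
      ((r ^ n : ℝ) : ℂ) * Complex.exp (((n * φ : ℝ) : ℂ) * Complex.I) := by
    rw [mul_pow, ← Complex.exp_nat_mul]
    push_cast
    ring_nf
  rw [hw]
  generalize r ^ n = ρ
  generalize (n * φ : ℝ) = θ
  have hre : ((ρ : ℂ) * Complex.exp ((θ : ℂ) * Complex.I)).re = ρ * Real.cos θ := by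
    rw [Complex.re_ofReal_mul, Complex.exp_ofReal_mul_I_re]
  have him : ((ρ : ℂ) * Complex.exp ((θ : ℂ) * Complex.I)).im = ρ * Real.sin θ := by
    rw [Complex.im_ofReal_mul, Complex.exp_ofReal_mul_I_im]
  rw [Complex.div_re, Complex.normSq_apply]
  simp only [Complex.sub_re, Complex.sub_im, Complex.one_re, Complex.one_im, hre, him, reKernel]
  have hs := Real.sin_sq_add_cos_sq θ
  rw [← add_div]
  congr 1
  · linear_combination ρ ^ 2 * hs
  · linear_combination ρ ^ 2 * hs

theorem iInt_eq (l j : ℕ) (φ : ℝ) :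
    iInt l j φ = ∫ r in (1 - (Nn l)⁻¹)..(1 - ((Nn l) ^ 2)⁻¹),
      2 ^ j * reKernel (r ^ (2 ^ (2 ^ j))) (Real.cos (Nn j * φ)) / weightDen r := by
  unfold iInt
  refine intervalIntegral.integral_congr fun r _ => ?_
  have := re_pow_div_pow_sub_one r φ (2 ^ (2 ^ j))
  simp only [this, weightDen, Nn]
  push_cast
  rfl

theorem reKernel_den_pos {ρ c : ℝ} (h0 : 0 ≤ ρ) (h1 : ρ < 1) (hc : c ≤ 1) :
    0 < 1 - 2 * ρ * c + ρ ^ 2 := by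
  nlinarith [mul_nonneg h0 (sub_nonneg.2 hc), mul_pos (sub_pos.2 h1) (sub_pos.2 h1)]

theorem reKernel_pos {ρ c : ℝ} (h0 : 0 < ρ) (h1 : ρ < 1) (hc : c < ρ) : 0 < reKernel ρ c :=
  div_pos (mul_pos h0 (sub_pos.2 hc)) (reKernel_den_pos h0.le h1 (hc.le.trans h1.le))

theorem abs_reKernel_le {ρ c : ℝ} (h0 : 0 ≤ ρ) (h1 : ρ < 1) (hc : c ≤ 1) (hc' : -1 ≤ c) :
    |reKernel ρ c| ≤ ρ / (1 - ρ) := by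
  have hd := reKernel_den_pos h0 h1 hc
  have hρ : 0 < 1 - ρ := sub_pos.2 h1
  rw [reKernel, abs_div, abs_of_pos hd, abs_mul, abs_of_nonneg h0, div_le_div_iff₀ hd hρ, mul_assoc]
  refine mul_le_mul_of_nonneg_left ?_ h0
  have h2 := mul_nonneg h0 (sub_nonneg.2 hc)
  rcases abs_cases (ρ - c) with ⟨h, _⟩ | ⟨h, _⟩ <;> rw [h]
  · nlinarith [mul_nonneg h0 (by linarith : 0 ≤ 1 + c)]
  · nlinarith

theorem reKernel_lower {ρ c A t : ℝ} (h0 : 0 < ρ) (h1 : ρ < 1) (hA : 1 ≤ A)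
    (hc : c ≤ 1 - A⁻¹) (ht : 1 - t ≤ ρ) : 1 / 10 - 4 * A ^ 2 * t ≤ reKernel ρ c := by
  have hA0 : 0 < A := by linarith
  have hAi : 0 < A⁻¹ := inv_pos.2 hA0
  have hAi1 : A⁻¹ ≤ 1 := inv_le_one_of_one_le₀ hA
  have hAA : A * A⁻¹ = 1 := mul_inv_cancel₀ hA0.ne'
  have hd := reKernel_den_pos h0.le h1 (by linarith : c ≤ 1)
  have hρ : 0 < 1 - ρ := sub_pos.2 h1
  rcases le_or_gt (A⁻¹ / 2) t with h | h
  · have hM : 2 * A ≤ 4 * A ^ 2 * t := by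
      calc 2 * A = 4 * A ^ 2 * (A⁻¹ / 2) := by field_simp; norm_num
        _ ≤ _ := by gcongr
    have hK : -A ≤ reKernel ρ c := by
      rcases le_or_gt c ρ with hcρ | hcρ
      · exact (by linarith : -A ≤ 0).trans
          (div_nonneg (mul_nonneg h0.le (sub_nonneg.2 hcρ)) hd.le)
      · have h3 : 1 ≤ A * (1 - ρ) := by
          rw [← hAA]; gcongr; linarith
        rw [reKernel, le_div_iff₀ hd]
        have h4 : (1 - ρ) ^ 2 ≤ 1 - 2 * ρ * c + ρ ^ 2 := by nlinarith
        have h5 : 1 - ρ ≤ A * (1 - 2 * ρ * c + ρ ^ 2) := by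
          calc 1 - ρ ≤ (A * (1 - ρ)) * (1 - ρ) := le_mul_of_one_le_left hρ.le h3
            _ = A * (1 - ρ) ^ 2 := by ring
            _ ≤ _ := by gcongr
        nlinarith
    linarith
  · have hM : 0 ≤ 4 * A ^ 2 * t := by
      have : 0 ≤ t := by linarith
      positivity
    have hK : 1 / 10 ≤ reKernel ρ c := by
      rw [reKernel, le_div_iff₀ hd]
      have hx : 1 - ρ ≤ (1 - c) / 2 := by linarith
      have hρ2 : 1 / 2 ≤ ρ := by linarith
      nlinarith [mul_le_mul hx hx hρ.le (by linarith), mul_nonneg h0.le (sub_nonneg.2 hx)]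
    linarith

theorem two_pow_le_Nn (l : ℕ) : (2 : ℝ) ^ l ≤ Nn l := by
  unfold Nn
  exact pow_le_pow_right₀ (by norm_num) Nat.lt_two_pow_self.le

theorem two_le_Nn (l : ℕ) : 2 ≤ Nn l := by
  unfold Nn
  exact le_self_pow₀ (by norm_num) (by positivity)

theorem Nn_succ (l : ℕ) : Nn (l + 1) = Nn l ^ 2 := by
  unfold Nn
  rw [← pow_mul, pow_succ]

theorem Nn_mono : Monotone Nn := fun _ _ h =>
  pow_le_pow_right₀ (by norm_num) (Nat.pow_le_pow_right (by norm_num) h)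

theorem log_Nn (l : ℕ) : Real.log (Nn l) = 2 ^ l * Real.log 2 := by
  unfold Nn
  rw [Real.log_pow]
  push_cast
  rfl

theorem log_Nn_pos (l : ℕ) : 0 < Real.log (Nn l) :=
  Real.log_pos (by linarith [two_le_Nn l])

theorem endpoint_lt (l : ℕ) : 1 - (Nn l)⁻¹ < 1 - ((Nn l) ^ 2)⁻¹ := by
  have h := two_le_Nn l
  have : ((Nn l) ^ 2)⁻¹ < (Nn l)⁻¹ := by
    apply inv_strictAnti₀ (by linarith)
    nlinarith
  linarith

theorem one_sub_pos_of_mem {l : ℕ} {r : ℝ}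
    (hr : r ∈ Icc (1 - (Nn l)⁻¹) (1 - ((Nn l) ^ 2)⁻¹)) :
    0 < 1 - r := by
  have h := two_le_Nn l
  have : 0 < ((Nn l) ^ 2)⁻¹ := by positivity
  linarith [hr.2]

theorem pos_of_mem {l : ℕ} {r : ℝ}
    (hr : r ∈ Icc (1 - (Nn l)⁻¹) (1 - ((Nn l) ^ 2)⁻¹)) :
    0 < r := by
  have h := two_le_Nn l
  have : (Nn l)⁻¹ ≤ 2⁻¹ := inv_anti₀ (by norm_num) h
  have := hr.1
  linarith

theorem log_Nn_le_of_mem {l : ℕ} {r : ℝ}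
    (hr : r ∈ Icc (1 - (Nn l)⁻¹) (1 - ((Nn l) ^ 2)⁻¹)) :
    Real.log (Nn l) ≤ Real.log (1 / (1 - r)) := by
  have h := two_le_Nn l
  apply Real.log_le_log (by linarith)
  rw [le_div_iff₀ (one_sub_pos_of_mem hr)]
  have h1 : 1 - r ≤ (Nn l)⁻¹ := by linarith [hr.1]
  calc Nn l * (1 - r) ≤ Nn l * (Nn l)⁻¹ := by gcongr
    _ = 1 := mul_inv_cancel₀ (by linarith)

theorem log_pos_of_mem {l : ℕ} {r : ℝ}
    (hr : r ∈ Icc (1 - (Nn l)⁻¹) (1 - ((Nn l) ^ 2)⁻¹)) :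
    0 < Real.log (1 / (1 - r)) :=
  (log_Nn_pos l).trans_le (log_Nn_le_of_mem hr)

theorem weightDen_pos_of_mem {l : ℕ} {r : ℝ}
    (hr : r ∈ Icc (1 - (Nn l)⁻¹) (1 - ((Nn l) ^ 2)⁻¹)) :
    0 < weightDen r :=
  mul_pos (one_sub_pos_of_mem hr) (pow_pos (log_pos_of_mem hr) 2)

theorem one_sub_mul_le_pow {r : ℝ} (h0 : 0 < r) (n : ℕ) : 1 - n * (1 - r) ≤ r ^ n := by
  have := one_add_mul_le_pow (a := r - 1) (by linarith) n
  rw [add_sub_cancel] at this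
  linarith

theorem pow_div_one_sub_pow_le {r : ℝ} (h0 : 0 < r) (h1 : r < 1) {n : ℕ} (hn : n ≠ 0) :
    r ^ n / (1 - r ^ n) ≤ 1 / (n * (1 - r)) := by
  have hn' : (0 : ℝ) < n := by exact_mod_cast Nat.pos_of_ne_zero hn
  have hd : 0 < 1 - r ^ n := sub_pos.2 (pow_lt_one₀ h0.le h1 hn)
  rw [div_le_div_iff₀ hd (mul_pos hn' (sub_pos.2 h1)), one_mul]
  have hinv := one_sub_mul_le_pow (inv_pos.2 h0) n
  have hr : 1 - r ≤ r⁻¹ - 1 := by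
    have h2 : r * r⁻¹ = 1 := mul_inv_cancel₀ h0.ne'
    have h3 : 1 < r⁻¹ := (one_lt_inv₀ h0).2 h1
    nlinarith [mul_pos (sub_pos.2 h1) (sub_pos.2 h3)]
  have h4 : 1 + n * (1 - r) ≤ (r ^ n)⁻¹ := by
    rw [← inv_pow]
    nlinarith
  have hp : 0 < r ^ n := pow_pos h0 n
  have h5 := mul_le_mul_of_nonneg_left h4 hp.le
  rw [mul_inv_cancel₀ hp.ne'] at h5
  linarith

theorem continuousOn_weightDen (l : ℕ) :
    ContinuousOn weightDen (Icc (1 - (Nn l)⁻¹) (1 - ((Nn l) ^ 2)⁻¹)) := by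
  unfold weightDen
  have h : ∀ r ∈ Icc (1 - (Nn l)⁻¹) (1 - ((Nn l) ^ 2)⁻¹), 1 - r ≠ 0 := fun r hr =>
    (one_sub_pos_of_mem hr).ne'
  refine ContinuousOn.mul (by fun_prop) (ContinuousOn.pow (ContinuousOn.log ?_ ?_) 2)
  · exact continuousOn_const.div (by fun_prop) h
  · exact fun r hr => one_div_ne_zero (h r hr)

theorem continuousOn_integrand (l n : ℕ) (hn : n ≠ 0) (C c : ℝ) (hc : c ≤ 1) :
    ContinuousOn (fun r => C * reKernel (r ^ n) c / weightDen r)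
      (Icc (1 - (Nn l)⁻¹) (1 - ((Nn l) ^ 2)⁻¹)) := by
  refine ContinuousOn.div (continuousOn_const.mul ?_) (continuousOn_weightDen l)
    fun r hr => (weightDen_pos_of_mem hr).ne'
  unfold reKernel
  refine ContinuousOn.div (by fun_prop) (by fun_prop) fun r hr => ?_
  have h0 := pos_of_mem hr
  have h1 : r < 1 := sub_pos.1 (one_sub_pos_of_mem hr)
  exact (reKernel_den_pos (pow_pos h0 n).le (pow_lt_one₀ h0.le h1 hn) hc).ne'

theorem integral_inv_weightDen (l : ℕ) :
    ∫ r in (1 - (Nn l)⁻¹)..(1 - ((Nn l) ^ 2)⁻¹), (weightDen r)⁻¹ =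
      1 / (2 * Real.log (Nn l)) := by
  have hL := log_Nn_pos l
  have hle := (endpoint_lt l).le
  have hderiv : ∀ r ∈ uIcc (1 - (Nn l)⁻¹) (1 - ((Nn l) ^ 2)⁻¹),
      HasDerivAt (fun r => (Real.log (1 - r))⁻¹) (weightDen r)⁻¹ r := by
    intro r hr
    rw [uIcc_of_le hle] at hr
    have h0 := one_sub_pos_of_mem hr
    have hlog := log_pos_of_mem hr
    have hneg : Real.log (1 / (1 - r)) = -Real.log (1 - r) := by
      rw [one_div, Real.log_inv]
    have hne : Real.log (1 - r) ≠ 0 := by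
      intro h
      rw [hneg, h] at hlog
      simp at hlog
    refine ((((hasDerivAt_id r).const_sub 1).log h0.ne').inv hne).congr_deriv ?_
    unfold weightDen
    rw [hneg]
    simp only [id]
    field_simp
  rw [intervalIntegral.integral_eq_sub_of_hasDerivAt hderiv]
  · simp only [sub_sub_cancel, Real.log_inv, Real.log_pow]
    push_cast
    field_simp
    norm_num
  · apply ContinuousOn.intervalIntegrable
    rw [uIcc_of_le hle]
    exact (continuousOn_weightDen l).inv₀ fun r hr => (weightDen_pos_of_mem hr).ne'

theorem continuousOn_inv_one_sub_sq (l : ℕ) :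
    ContinuousOn (fun r : ℝ => ((1 - r) ^ 2)⁻¹) (Icc (1 - (Nn l)⁻¹) (1 - ((Nn l) ^ 2)⁻¹)) :=
  ContinuousOn.inv₀ (by fun_prop) fun _ hr => (pow_pos (one_sub_pos_of_mem hr) 2).ne'

theorem integral_inv_one_sub_sq_le (l : ℕ) :
    ∫ r in (1 - (Nn l)⁻¹)..(1 - ((Nn l) ^ 2)⁻¹), ((1 - r) ^ 2)⁻¹ ≤ Nn l ^ 2 := by
  have hle := (endpoint_lt l).le
  have hderiv : ∀ r ∈ uIcc (1 - (Nn l)⁻¹) (1 - ((Nn l) ^ 2)⁻¹),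
      HasDerivAt (fun r : ℝ => (1 - r)⁻¹) ((1 - r) ^ 2)⁻¹ r := by
    intro r hr
    rw [uIcc_of_le hle] at hr
    have h0 := one_sub_pos_of_mem hr
    refine (((hasDerivAt_id r).const_sub 1).inv h0.ne').congr_deriv ?_
    simp
  rw [intervalIntegral.integral_eq_sub_of_hasDerivAt hderiv]
  · simp only [sub_sub_cancel, inv_inv]
    linarith [two_le_Nn l]
  · apply ContinuousOn.intervalIntegrable
    rw [uIcc_of_le hle]
    exact continuousOn_inv_one_sub_sq l

theorem Nn_eq_cast (j : ℕ) : Nn j = ((2 ^ (2 ^ j) : ℕ) : ℝ) := by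
  unfold Nn
  push_cast
  rfl

theorem iInt_pos {l j : ℕ} {φ : ℝ} (h : Real.cos (Nn j * φ) < 1 - Nn j / Nn l) :
    0 < iInt l j φ := by
  rw [iInt_eq]
  have hlt := endpoint_lt l
  have hn : 2 ^ (2 ^ j) ≠ 0 := by positivity
  apply intervalIntegral.intervalIntegral_pos_of_pos_on _ _ hlt
  · apply ContinuousOn.intervalIntegrable
    rw [uIcc_of_le hlt.le]
    exact continuousOn_integrand l _ hn _ _ (Real.cos_le_one _)
  · intro r hr
    have hr := Ioo_subset_Icc_self hr
    have h0 := pos_of_mem hr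
    have h1 : r < 1 := sub_pos.1 (one_sub_pos_of_mem hr)
    refine div_pos (mul_pos (by positivity) (reKernel_pos (pow_pos h0 _)
      (pow_lt_one₀ h0.le h1 hn) ?_)) (weightDen_pos_of_mem hr)
    refine h.trans_le (le_trans ?_ (one_sub_mul_le_pow h0 _))
    rw [← Nn_eq_cast, div_eq_mul_inv]
    have hN := two_le_Nn j
    have : Nn j * (1 - r) ≤ Nn j * (Nn l)⁻¹ := by
      apply mul_le_mul_of_nonneg_left _ (by linarith)
      linarith [hr.1]
    linarith

theorem iInt_self_lower {l : ℕ} {φ A : ℝ} (hA : 1 ≤ A) (hc : Real.cos (Nn l * φ) ≤ 1 - A⁻¹) :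
    1 / 20 - 16 * A ^ 2 / 2 ^ l ≤ iInt l l φ := by
  rw [iInt_eq]
  have hlt := endpoint_lt l
  have hn : 2 ^ (2 ^ l) ≠ 0 := by positivity
  have hL := log_Nn_pos l
  have hN := two_le_Nn l
  set L := Real.log (Nn l) with hLdef
  set B := 2 ^ l * (4 * A ^ 2 * Nn l) / L ^ 2 with hB
  have hB0 : 0 ≤ B := by positivity
  have hwint : IntervalIntegrable (fun r => (weightDen r)⁻¹) volume
      (1 - (Nn l)⁻¹) (1 - ((Nn l) ^ 2)⁻¹) := by
    apply ContinuousOn.intervalIntegrable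
    rw [uIcc_of_le hlt.le]
    exact (continuousOn_weightDen l).inv₀ fun r hr => (weightDen_pos_of_mem hr).ne'
  have key : ∫ r in (1 - (Nn l)⁻¹)..(1 - ((Nn l) ^ 2)⁻¹), (2 ^ l / 10 * (weightDen r)⁻¹ - B) ≤
      ∫ r in (1 - (Nn l)⁻¹)..(1 - ((Nn l) ^ 2)⁻¹),
        2 ^ l * reKernel (r ^ (2 ^ (2 ^ l))) (Real.cos (Nn l * φ)) / weightDen r := by
    apply intervalIntegral.integral_mono_on hlt.le
    · exact (hwint.const_mul _).sub intervalIntegrable_const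
    · apply ContinuousOn.intervalIntegrable
      rw [uIcc_of_le hlt.le]
      exact continuousOn_integrand l _ hn _ _ (Real.cos_le_one _)
    · intro r hr
      have h0 := pos_of_mem hr
      have hs := one_sub_pos_of_mem hr
      have hw := weightDen_pos_of_mem hr
      have hp := one_sub_mul_le_pow h0 (2 ^ (2 ^ l))
      rw [← Nn_eq_cast] at hp
      have hK := reKernel_lower (pow_pos h0 _) (pow_lt_one₀ h0.le (sub_pos.1 hs) hn) hA hc hp
      have hlog := log_Nn_le_of_mem hr
      have hB' : 2 ^ l * (4 * A ^ 2 * (Nn l * (1 - r))) / weightDen r ≤ B := by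
        have : 2 ^ l * (4 * A ^ 2 * (Nn l * (1 - r))) / weightDen r =
            2 ^ l * (4 * A ^ 2 * Nn l) / (Real.log (1 / (1 - r))) ^ 2 := by
          have := log_pos_of_mem hr
          unfold weightDen
          field_simp
        rw [this, hB]
        gcongr
      calc 2 ^ l / 10 * (weightDen r)⁻¹ - B
          ≤ 2 ^ l / 10 * (weightDen r)⁻¹ -
            2 ^ l * (4 * A ^ 2 * (Nn l * (1 - r))) / weightDen r := by linarith
        _ = 2 ^ l * (1 / 10 - 4 * A ^ 2 * (Nn l * (1 - r))) / weightDen r := by ring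
        _ ≤ _ := by gcongr
  refine le_trans ?_ key
  rw [intervalIntegral.integral_sub (hwint.const_mul _) intervalIntegrable_const,
    intervalIntegral.integral_const_mul, integral_inv_weightDen, intervalIntegral.integral_const,
    smul_eq_mul]
  have hlen : (1 - ((Nn l) ^ 2)⁻¹ - (1 - (Nn l)⁻¹)) * B ≤ (Nn l)⁻¹ * B := by
    have : 0 ≤ ((Nn l) ^ 2)⁻¹ := by positivity
    gcongr
    linarith
  have hl2 := Real.log_two_gt_d9
  have hl2' := Real.log_two_lt_d9
  have hBe : (Nn l)⁻¹ * B = 4 * A ^ 2 / (2 ^ l * Real.log 2 ^ 2) := by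
    rw [hB, hLdef, log_Nn]
    field_simp
  have hBl : (Nn l)⁻¹ * B ≤ 16 * A ^ 2 / 2 ^ l := by
    rw [hBe, div_le_div_iff₀ (by positivity) (by positivity)]
    have : (1 : ℝ) ≤ 4 * Real.log 2 ^ 2 := by nlinarith
    calc 4 * A ^ 2 * 2 ^ l = 4 * A ^ 2 * 2 ^ l * 1 := by ring
      _ ≤ 4 * A ^ 2 * 2 ^ l * (4 * Real.log 2 ^ 2) := by gcongr
      _ = _ := by ring
  have hmain : 1 / 20 ≤ 2 ^ l / 10 * (1 / (2 * L)) := by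
    have : 2 ^ l / 10 * (1 / (2 * L)) = 1 / (20 * Real.log 2) := by
      rw [hLdef, log_Nn]
      field_simp
      norm_num
    rw [this]
    apply one_div_le_one_div_of_le (by positivity)
    linarith
  linarith

theorem Nn_mul_four_pow_le (l k : ℕ) : Nn (l + 1) * 4 ^ k ≤ Nn (l + 1 + k) := by
  induction k with
  | zero => simp
  | succ k ih =>
    rw [← add_assoc, Nn_succ (l + 1 + k), pow_succ, ← mul_assoc, sq]
    have h4 : 4 ≤ Nn (l + 1 + k) := by
      have h1 : Nn 1 = 4 := by norm_num [Nn]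
      rw [← h1]
      exact Nn_mono (by omega)
    exact mul_le_mul ih h4 (by norm_num) (by linarith)

theorem abs_iInt_le (l k : ℕ) (φ : ℝ) :
    |iInt l (l + 1 + k) φ| ≤ 8 / 2 ^ l * (1 / 2) ^ k := by
  rw [iInt_eq]
  set j := l + 1 + k with hj
  have hlt := endpoint_lt l
  have hn : 2 ^ (2 ^ j) ≠ 0 := by positivity
  have hL := log_Nn_pos l
  have hN := two_le_Nn l
  have hNj := two_le_Nn j
  set L := Real.log (Nn l) with hLdef
  have hbound : |∫ r in (1 - (Nn l)⁻¹)..(1 - ((Nn l) ^ 2)⁻¹),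
        2 ^ j * reKernel (r ^ (2 ^ (2 ^ j))) (Real.cos (Nn j * φ)) / weightDen r| ≤
      ∫ r in (1 - (Nn l)⁻¹)..(1 - ((Nn l) ^ 2)⁻¹),
        2 ^ j / (Nn j * L ^ 2) * ((1 - r) ^ 2)⁻¹ := by
    rw [← Real.norm_eq_abs]
    apply intervalIntegral.norm_integral_le_of_norm_le hlt.le
    · refine Eventually.of_forall fun r hr => ?_
      have hr := Ioc_subset_Icc_self hr
      have h0 := pos_of_mem hr
      have hs := one_sub_pos_of_mem hr
      have hw := weightDen_pos_of_mem hr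
      have hlog := log_Nn_le_of_mem hr
      have hK := (abs_reKernel_le (pow_pos h0 _).le (pow_lt_one₀ h0.le (sub_pos.1 hs) hn)
        (Real.cos_le_one (Nn j * φ)) (Real.neg_one_le_cos _)).trans
        (pow_div_one_sub_pow_le h0 (sub_pos.1 hs) hn)
      rw [← Nn_eq_cast] at hK
      rw [Real.norm_eq_abs, abs_div, abs_mul, abs_of_pos hw,
        abs_of_pos (by positivity : (0 : ℝ) < 2 ^ j)]
      have hwl : (1 - r) * L ^ 2 ≤ weightDen r := by
        unfold weightDen
        gcongr
      calc 2 ^ j * |reKernel (r ^ (2 ^ (2 ^ j))) (Real.cos (Nn j * φ))| / weightDen r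
          ≤ 2 ^ j * (1 / (Nn j * (1 - r))) / ((1 - r) * L ^ 2) := by gcongr
        _ = _ := by field_simp
    · apply IntervalIntegrable.const_mul
      apply ContinuousOn.intervalIntegrable
      rw [uIcc_of_le hlt.le]
      exact continuousOn_inv_one_sub_sq l
  refine hbound.trans ?_
  rw [intervalIntegral.integral_const_mul]
  have hl2 := Real.log_two_gt_d9
  have hlog2 : (1 : ℝ) ≤ 4 * Real.log 2 ^ 2 := by nlinarith
  have h4 := Nn_mul_four_pow_le l k
  rw [Nn_succ] at h4
  have hden : (4 : ℝ) ^ k * 4 ^ l * Nn l ^ 2 ≤ 4 * (Nn j * L ^ 2) := by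
    have hL2 : L ^ 2 = 4 ^ l * Real.log 2 ^ 2 := by
      rw [hLdef, log_Nn, mul_pow, ← pow_mul, mul_comm l 2, pow_mul]
      norm_num
    rw [hL2]
    calc (4 : ℝ) ^ k * 4 ^ l * Nn l ^ 2 = (Nn l ^ 2 * 4 ^ k) * 4 ^ l * 1 := by ring
      _ ≤ Nn j * 4 ^ l * (4 * Real.log 2 ^ 2) := by gcongr
      _ = _ := by ring
  calc 2 ^ j / (Nn j * L ^ 2) * ∫ r in (1 - (Nn l)⁻¹)..(1 - ((Nn l) ^ 2)⁻¹), ((1 - r) ^ 2)⁻¹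
      ≤ 2 ^ j / (Nn j * L ^ 2) * Nn l ^ 2 := by
        gcongr
        exact integral_inv_one_sub_sq_le l
    _ ≤ 2 ^ j * 4 / (4 ^ k * 4 ^ l) := by
        rw [div_mul_eq_mul_div, div_le_div_iff₀ (by positivity) (by positivity)]
        calc 2 ^ j * Nn l ^ 2 * (4 ^ k * 4 ^ l) = 2 ^ j * (4 ^ k * 4 ^ l * Nn l ^ 2) := by ring
          _ ≤ 2 ^ j * (4 * (Nn j * L ^ 2)) := by gcongr
          _ = _ := by ring
    _ = 8 / 2 ^ l * (1 / 2) ^ k := by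
        have e : ∀ n : ℕ, (4 : ℝ) ^ n = 2 ^ n * 2 ^ n := fun n => by
          rw [← mul_pow]
          norm_num
        rw [hj, pow_add, pow_add, e, e, one_div, inv_pow]
        field_simp
        norm_num

theorem tsum_abs_iInt_le (l : ℕ) (φ : ℝ) :
    ∑' k : ℕ, |iInt l (l + 1 + k) φ| ≤ 16 / 2 ^ l := by
  have hg : Summable fun k : ℕ => (8 / 2 ^ l : ℝ) * (1 / 2) ^ k :=
    summable_geometric_two.mul_left _
  have hf : Summable fun k : ℕ => |iInt l (l + 1 + k) φ| :=
    Summable.of_nonneg_of_le (fun _ => abs_nonneg _) (fun k => abs_iInt_le l k φ) hg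
  refine (hf.tsum_le_tsum (fun k => abs_iInt_le l k φ) hg).trans_eq ?_
  rw [tsum_mul_left, tsum_geometric_two]
  ring

theorem eventually_rpow_sq_le_two_pow (a : ℝ) :
    ∀ᶠ n : ℕ in atTop, 2000 * ((n : ℝ) ^ a) ^ 2 ≤ 2 ^ n := by
  have h := (isLittleO_rpow_exp_pos_mul_atTop (a * 2) (Real.log_pos one_lt_two)).comp_tendsto
    tendsto_natCast_atTop_atTop
  filter_upwards [h.bound (by norm_num : (0 : ℝ) < 1 / 2000)] with n hn
  simp only [Function.comp, Real.norm_eq_abs] at hn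
  rw [abs_of_nonneg (by positivity), abs_of_pos (Real.exp_pos _), mul_comm (Real.log 2),
    Real.exp_nat_mul, Real.exp_log two_pos, Real.rpow_mul (Nat.cast_nonneg n)] at hn
  norm_cast at hn ⊢
  push_cast at hn ⊢
  linarith

theorem stmt_13 (a : ℝ) (ha : 2 < a) :
    ∀ m : ℕ, 1 ≤ m → ∀ φ ∈ Ioc (-π) π, φ ∉ Fm a m →
      ∃ γ : ℝ, 0 < γ ∧ ∃ l₀ : ℕ, m < l₀ ∧ ∀ l : ℕ, l₀ < l →
        (∀ j : ℕ, 1 ≤ j → j < l → 0 < iInt l j φ) ∧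
        2 * γ < iInt l l φ ∧
        (∑' k : ℕ, |iInt l (l + 1 + k) φ|) < γ := by
  intro m hm φ hφ hF
  have hE : ∀ n, m ≤ n → Real.cos (Nn n * φ) ≤ 1 - ((n : ℝ) ^ a)⁻¹ := by
    intro n hn
    by_contra! h
    rw [← Real.rpow_neg (Nat.cast_nonneg n)] at h
    exact hF (Or.inl (mem_iUnion₂.2 ⟨n, hn, hφ, h⟩))
  have hE' : ∀ n, 1 ≤ n → n < m → Real.cos (Nn n * φ) ≤ 1 - (Nn m)⁻¹ := by
    intro n hn hnm
    by_contra! h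
    exact hF (Or.inr (mem_iUnion₂.2 ⟨n, ⟨hn, hnm⟩, hφ, h⟩))
  obtain ⟨n₀, hn₀⟩ := eventually_atTop.1 (eventually_rpow_sq_le_two_pow a)
  have hrpow : ∀ n : ℕ, 1 ≤ n → 1 ≤ (n : ℝ) ^ a := fun n hn =>
    Real.one_le_rpow (by exact_mod_cast hn) (by linarith)
  refine ⟨1 / 100, by norm_num, max n₀ m + 1, by omega, fun l hl => ⟨fun j hj hjl => ?_, ?_, ?_⟩⟩
  · apply iInt_pos
    obtain ⟨s, rfl⟩ : ∃ s, l = s + 1 := ⟨l - 1, by omega⟩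
    have hNs := two_le_Nn s
    have hNj := two_le_Nn j
    rw [Nn_succ]
    rcases le_or_gt m j with hmj | hmj
    · refine (hE j hmj).trans_lt (sub_lt_sub_left ?_ 1)
      have hjs : (j : ℝ) ^ a ≤ (s : ℝ) ^ a :=
        Real.rpow_le_rpow (Nat.cast_nonneg j) (by exact_mod_cast (by omega : j ≤ s)) (by linarith)
      have h1 := hrpow j hj
      have h2 := hn₀ s (by omega)
      have h3 := two_pow_le_Nn s
      have h4 : (j : ℝ) ^ a < Nn s := by nlinarith
      have h5 : Nn j ≤ Nn s := Nn_mono (by omega)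
      rw [inv_eq_one_div, div_lt_div_iff₀ (by positivity) (by linarith)]
      calc Nn j * (j : ℝ) ^ a ≤ Nn s * (j : ℝ) ^ a := by gcongr
        _ < Nn s * Nn s := by gcongr
        _ = _ := by ring
    · refine (hE' j hj hmj).trans_lt (sub_lt_sub_left ?_ 1)
      have hNm := two_le_Nn m
      have h5 : Nn j < Nn m := by
        have h6 : Nn (j + 1) ≤ Nn m := Nn_mono hmj
        rw [Nn_succ] at h6
        nlinarith
      have h7 : Nn m ≤ Nn s := Nn_mono (by omega)
      rw [inv_eq_one_div, div_lt_div_iff₀ (by positivity) (by linarith)]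
      nlinarith
  · have h1 := hrpow l (by omega)
    have h2 := hn₀ l (by omega)
    have h3 := iInt_self_lower h1 (hE l (by omega))
    have h4 : 16 * ((l : ℝ) ^ a) ^ 2 / 2 ^ l ≤ 16 / 2000 := by
      rw [div_le_div_iff₀ (by positivity) (by norm_num)]
      linarith
    linarith
  · refine (tsum_abs_iInt_le l φ).trans_lt ?_
    have h1 := hrpow l (by omega)
    have h2 := hn₀ l (by omega)
    rw [div_lt_div_iff₀ (by positivity) (by norm_num)]
    nlinarith
end
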